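/- Let C ≥ 2 and let ℓ : Δ^{C−1} → ℝ^C be a loss with conditional risk L(p,q) = Σ_{i=1}^C p_i ℓ_i(q). Then ℓ is proper if and only if there exists a convex function f : Δ^{C−1} → ℝ such that for every q ∈ Δ^{C−1} there exists a subgradient φ_q of f at q (relative to Δ^{C−1}) satisfying L(p,q) = −⟨φ_q, p − q⟩ − f(q) for all p ∈ Δ^{C−1}. -/

import Mathlib

/-- The probability simplex `Δ^{C-1} ⊆ ℝ^C`. -/
def simplex (C : ℕ) : Set (Fin C → ℝ) :=
  {p | (∀ i, 0 ≤ p i) ∧ ∑ i, p i = 1}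

/-- A loss `ℓ : Δ^{C-1} → ℝ^C` with conditional risk `L(p,q) = ∑ i, p i * ℓ_i(q)` is proper
iff there is a convex `f` on the simplex such that for every `q` in the simplex there is a
subgradient `φ` of `f` at `q` (relative to the simplex) with
`L(p,q) = -⟨φ, p - q⟩ - f q` for all `p` in the simplex. -/
theorem stmt_2 (C : ℕ) (hC : 2 ≤ C) (ℓ : (Fin C → ℝ) → (Fin C → ℝ)) :
    (∀ p ∈ simplex C, ∀ q ∈ simplex C, ∑ i, p i * ℓ p i ≤ ∑ i, p i * ℓ q i) ↔
      ∃ f : (Fin C → ℝ) → ℝ, ConvexOn ℝ (simplex C) f ∧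
        ∀ q ∈ simplex C, ∃ φ : Fin C → ℝ,
          (∀ y ∈ simplex C, f q + ∑ i, φ i * (y i - q i) ≤ f y) ∧
          (∀ p ∈ simplex C, ∑ i, p i * ℓ q i = -(∑ i, φ i * (p i - q i)) - f q) := by
  constructor
  · intro h
    have hconv : Convex ℝ (simplex C) := by
      intro x hx y hy a b ha hb hab
      refine ⟨fun i => ?_, ?_⟩
      · have h1 := mul_nonneg ha (hx.1 i)
        have h2 := mul_nonneg hb (hy.1 i)
        simp only [Pi.add_apply, Pi.smul_apply, smul_eq_mul]
        linarith
      · simp only [Pi.add_apply, Pi.smul_apply, smul_eq_mul, Finset.sum_add_distrib,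
          ← Finset.mul_sum, hx.2, hy.2]
        linarith
    have key : ∀ p q : Fin C → ℝ,
        ∑ i, (-ℓ q i) * (p i - q i) = (∑ i, q i * ℓ q i) - ∑ i, p i * ℓ q i := by
      intro p q
      rw [← Finset.sum_sub_distrib]
      exact Finset.sum_congr rfl fun i _ => by ring
    refine ⟨fun q => -∑ i, q i * ℓ q i, ⟨hconv, ?_⟩, ?_⟩
    · intro x hx y hy a b ha hb hab
      have hz := hconv hx hy ha hb hab
      have h1 := mul_le_mul_of_nonneg_left (h x hx _ hz) ha
      have h2 := mul_le_mul_of_nonneg_left (h y hy _ hz) hb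
      have h3 : ∀ v : Fin C → ℝ, ∑ i, (a • x + b • y) i * v i
          = a * ∑ i, x i * v i + b * ∑ i, y i * v i := by
        intro v
        rw [Finset.mul_sum, Finset.mul_sum, ← Finset.sum_add_distrib]
        refine Finset.sum_congr rfl fun i _ => ?_
        simp only [Pi.add_apply, Pi.smul_apply, smul_eq_mul]
        ring
      have h4 := h3 (ℓ (a • x + b • y))
      simp only [smul_eq_mul]
      linarith
    · intro q hq
      refine ⟨fun i => -ℓ q i, fun y hy => ?_, fun p hp => ?_⟩
      · have h1 := h y hy q hq
        have h2 := key y q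
        linarith
      · have h2 := key p q
        linarith
  · rintro ⟨f, -, hf⟩ p hp q hq
    obtain ⟨φ, -, h1⟩ := hf p hp
    obtain ⟨ψ, h2, h3⟩ := hf q hq
    have e1 := h1 p hp
    simp only [sub_self, mul_zero, Finset.sum_const_zero] at e1
    have e2 := h2 p hp
    have e3 := h3 p hp
    linarith
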